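/- Let $m, n$ be positive integers with $m \geq n$, and let $X, Y \in \mathbb{R}^{m \times n}$. Assume (i) $X^T Y = Y^T X$, and (ii) every square submatrix of $X$ (obtained by selecting any nonempty set of rows and an equally sized set of columns of $X$) is nonsingular. Then there exists a matrix $B \in \mathbb{R}^{m \times m}$ such that $B = B^T$, $B_{ij} = 0$ whenever $|j - i| > n - 1$, and $BX = Y$. -/

import Mathlib

open Matrix

namespace Matrix

variable {R : Type*} [CommRing R]

/-- If the first `n` rows of `X` form an invertible matrix, then every row vector is a
combination of the rows of `X` whose coefficients vanish beyond the first `n`. -/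
lemma exists_vecMul_eq_of_isUnit_submatrix_castLE {m n : ℕ} (hmn : n ≤ m)
    (X : Matrix (Fin m) (Fin n) R) (hX : IsUnit (X.submatrix (Fin.castLE hmn) id))
    (y : Fin n → R) :
    ∃ b : Fin m → R, (∀ j : Fin m, n ≤ (j : ℕ) → b j = 0) ∧ b ᵥ* X = y := by
  set A := X.submatrix (Fin.castLE hmn) id with hA
  set E : Matrix (Fin n) (Fin m) R := (1 : Matrix (Fin m) (Fin m) R).submatrix (Fin.castLE hmn) id
    with hE
  have hEX : E * X = A := by
    ext i j
    simp [hE, hA, mul_apply, one_apply]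
  refine ⟨(y ᵥ* A⁻¹) ᵥ* E, fun j hj => ?_, ?_⟩
  · rw [vecMul, dotProduct]
    refine Finset.sum_eq_zero fun i _ => ?_
    have hne : Fin.castLE hmn i ≠ j :=
      Fin.ne_of_lt (i.isLt.trans_le hj)
    rw [hE, submatrix_apply, id, one_apply_ne hne, mul_zero]
  · rw [vecMul_vecMul, hEX, vecMul_vecMul, nonsing_inv_mul _ ((isUnit_iff_isUnit_det A).mp hX),
      vecMul_one]

/-- If `Xᵀ * Y` is symmetric and every square submatrix of `X` of full width is invertible, then
`B * X = Y` has a symmetric solution `B` of band width `n - 1`. -/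
theorem exists_isSymm_banded_mul_eq {m n : ℕ} (hmn : n ≤ m) (X Y : Matrix (Fin m) (Fin n) R)
    (hsym : (Xᵀ * Y).IsSymm)
    (hX : ∀ r : Fin n → Fin m, Function.Injective r → IsUnit (X.submatrix r id)) :
    ∃ B : Matrix (Fin m) (Fin m) R, B.IsSymm ∧
      (∀ i j : Fin m, ((n : ℤ) - 1) < |(j : ℤ) - (i : ℤ)| → B i j = 0) ∧ B * X = Y := by
  induction m, hmn using Nat.le_induction with
  | base =>
    have hdet : IsUnit X.det := by
      simpa using (isUnit_iff_isUnit_det _).mp (hX id Function.injective_id)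
    refine ⟨Y * X⁻¹, ?_, fun i j h => ?_, by rw [Matrix.mul_assoc, nonsing_inv_mul _ hdet,
      Matrix.mul_one]⟩
    · have hdet' : IsUnit Xᵀ.det := by rwa [det_transpose]
      have h : Yᵀ * X = Xᵀ * Y := by simpa [IsSymm, transpose_mul] using hsym
      rw [IsSymm, transpose_mul, transpose_nonsing_inv]
      calc Xᵀ⁻¹ * Yᵀ = Xᵀ⁻¹ * (Yᵀ * X) * X⁻¹ := by
            rw [← Matrix.mul_assoc, Matrix.mul_assoc _ X, mul_nonsing_inv _ hdet, Matrix.mul_one]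
        _ = Y * X⁻¹ := by
            rw [h, ← Matrix.mul_assoc, nonsing_inv_mul _ hdet', Matrix.one_mul]
    · have hi := i.isLt
      have hj := j.isLt
      rcases lt_abs.mp h with h | h <;> omega
  | succ m hmn ih =>
    obtain ⟨b, hb, hbX⟩ := exists_vecMul_eq_of_isUnit_submatrix_castLE (Nat.le_succ_of_le hmn) X
      (hX _ (Fin.castLE_injective _)) (Y 0)
    have hrow (k : Fin n) : Y 0 k = b 0 * X 0 k + ∑ i : Fin m, b i.succ * X i.succ k := by
      rw [← hbX, vecMul, dotProduct, Fin.sum_univ_succ]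
    obtain ⟨B, hB, hband, hBX⟩ := ih (X.submatrix Fin.succ id)
      (of fun i k => Y i.succ k - b i.succ * X 0 k) (by
        ext k l
        have h : (Xᵀ * Y) l k = (Xᵀ * Y) k l := hsym.apply k l
        simp only [mul_apply, transpose_apply, Fin.sum_univ_succ, hrow] at h
        simp only [mul_apply, transpose_apply, submatrix_apply, of_apply, id, mul_sub,
          Finset.sum_sub_distrib, ← mul_assoc, ← Finset.sum_mul]
        simp only [mul_comm (X (Fin.succ _) _) (b _)]
        linear_combination h)
      (fun r hr => by
        simpa using hX (Fin.succ ∘ r) ((Fin.succ_injective m).comp hr))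
    refine ⟨of (Fin.cons b fun i => Fin.cons (b i.succ) (B i)), ?_, ?_, ?_⟩
    · ext i j
      cases i using Fin.cases <;> cases j using Fin.cases <;> simp [hB.apply]
    · intro i j h
      cases i using Fin.cases with
      | zero =>
        refine hb j ?_
        simp only [Fin.val_zero, Nat.cast_zero, sub_zero, Nat.abs_cast] at h
        omega
      | succ i =>
        cases j using Fin.cases with
        | zero =>
          refine hb i.succ ?_
          simp only [Fin.val_zero, Nat.cast_zero, zero_sub, abs_neg, Nat.abs_cast] at h
          omega
        | succ j => exact hband i j (by simpa using h)
    · ext i k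
      cases i using Fin.cases with
      | zero => simp [mul_apply, Fin.sum_univ_succ, hrow]
      | succ i =>
        have h := congrFun (congrFun hBX i) k
        simp only [mul_apply, submatrix_apply, of_apply, id] at h
        simp [mul_apply, Fin.sum_univ_succ, h]

end Matrix

/-- Lemma 2 of the paper: if `Xᵀ Y = Yᵀ X` and every (nonempty) square submatrix of `X`
is nonsingular, then the system `B X = Y` admits a symmetric solution `B` that is banded
with band width `n - 1`. -/
theorem stmt_2 {m n : ℕ} (hn : 0 < n) (hmn : n ≤ m)
    (X Y : Matrix (Fin m) (Fin n) ℝ)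
    (hsym : Xᵀ * Y = Yᵀ * X)
    (hsub : ∀ (k : ℕ), 0 < k → ∀ (r : Fin k → Fin m) (c : Fin k → Fin n),
      Function.Injective r → Function.Injective c → IsUnit (X.submatrix r c)) :
    ∃ B : Matrix (Fin m) (Fin m) ℝ, B = Bᵀ ∧
      (∀ i j : Fin m, ((n : ℤ) - 1) < |(j : ℤ) - (i : ℤ)| → B i j = 0) ∧
      B * X = Y := by
  obtain ⟨B, hB, hband, hBX⟩ := exists_isSymm_banded_mul_eq hmn X Y
    (by rw [IsSymm, transpose_mul, transpose_transpose, hsym])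
    (fun r hr => hsub n hn r id hr Function.injective_id)
  exact ⟨B, hB.symm, hband, hBX⟩
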